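/- arXiv:1210.8284 — 9 statements merged into one kernel-verified Lean document; each statement's English description precedes it below -/
import Mathlib

section
/- Let d ≥ 3 be an odd integer, n ≥ 1, F : (ℝ^n)^d → ℝ a symmetric d-multilinear form, and f(x) = F(x,…,x). Then for any x^1,…,x^d ∈ ℝ^n there exists β = (β_1,…,β_d) ∈ {−1,1}^d such that f(∑_{j=1}^d (∏_{i≠j} β_i) x^j) ≥ d! · F(x^1,…,x^d). -/
open Finset

/-- The sign of the monomial indexed by `s`, regrouped according to the entries of the sign
vector. -/
theorem prod_prod_erase_eq_prod_prod_ite {ι : Type*} [Fintype ι] [DecidableEq ι]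
    (s : ι → ι) (ε : ι → ℝ) :
    ∏ k, ∏ i ∈ univ.erase (s k), ε i = ∏ i, ∏ k, if i = s k then 1 else ε i := by
  rw [prod_comm]
  refine prod_congr rfl fun k _ => ?_
  rw [← mul_prod_erase univ _ (mem_univ (s k)), if_pos rfl, one_mul]
  exact prod_congr rfl fun i hi => (if_neg (ne_of_mem_erase hi)).symm

/-- Summing the sign of the monomial indexed by `s` over all sign vectors leaves only the
bijective `s`. -/
theorem sum_prod_prod_erase_sign {ι : Type*} [Fintype ι] [DecidableEq ι]
    (hodd : Odd (Fintype.card ι)) (s : ι → ι) :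
    ∑ β : ι → Bool, ∏ k, ∏ i ∈ univ.erase (s k), (if β i then (1 : ℝ) else -1) =
      if Function.Bijective s then 2 ^ Fintype.card ι else 0 := by
  simp_rw [prod_prod_erase_eq_prod_prod_ite s]
  rw [← Fintype.prod_sum fun (i : ι) (b : Bool) =>
    ∏ k, if i = s k then (1 : ℝ) else if b then 1 else -1]
  split_ifs with hs
  · rw [← card_univ, ← prod_const]
    refine prod_congr rfl fun i _ => ?_
    have hsign : ∏ k, (if i = s k then (1 : ℝ) else -1) = 1 := by
      rw [hs.prod_comp fun j => if i = j then (1 : ℝ) else -1,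
        ← mul_prod_erase univ _ (mem_univ i), if_pos rfl, one_mul,
        prod_congr rfl fun j hj => if_neg (ne_of_mem_erase hj).symm, prod_const,
        card_erase_of_mem (mem_univ i), card_univ]
      exact (Nat.Odd.sub_odd hodd odd_one).neg_one_pow
    simp [hsign, one_add_one_eq_two]
  · have hsurj : ¬ Function.Surjective s := fun h => hs (Finite.surjective_iff_bijective.1 h)
    simp only [Function.Surjective, not_forall, not_exists] at hsurj
    obtain ⟨i, hi⟩ := hsurj
    refine prod_eq_zero (mem_univ i) ?_
    simp [fun k => Ne.symm (hi k), hodd.neg_one_pow]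

/-- The sum over all sign vectors of the values of a symmetric form of odd degree at the signed
sums of its arguments recovers the form. -/
theorem MultilinearMap.sum_map_sum_prod_erase_sign {ι E : Type*} [Fintype ι] [DecidableEq ι]
    [AddCommGroup E] [Module ℝ E] (hodd : Odd (Fintype.card ι))
    (F : MultilinearMap ℝ (fun _ : ι => E) ℝ)
    (hsym : ∀ (σ : Equiv.Perm ι) (x : ι → E), F (fun i => x (σ i)) = F x) (x : ι → E) :
    ∑ β : ι → Bool, F (fun _ => ∑ j,
        (∏ i ∈ univ.erase j, (if β i then (1 : ℝ) else -1)) • x j) =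
      2 ^ Fintype.card ι * ((Fintype.card ι).factorial * F x) := by
  have hterm : ∀ s : ι → ι,
      (if Function.Bijective s then (2 : ℝ) ^ Fintype.card ι else 0) * F (fun k => x (s k)) =
        if Function.Bijective s then 2 ^ Fintype.card ι * F x else 0 := by
    intro s
    split_ifs with hs
    · rw [← hsym (Equiv.ofBijective s hs) x]
      rfl
    · exact zero_mul _
  have hcard : #{s : ι → ι | Function.Bijective s} = (Fintype.card ι).factorial := by
    rw [← Fintype.card_subtype, ← Fintype.card_perm]
    exact Fintype.card_congr (Equiv.ofBijective
      (fun s : {s : ι → ι // Function.Bijective s} => Equiv.ofBijective s.1 s.2)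
      ⟨fun s t h => Subtype.ext (congrArg (fun σ : Equiv.Perm ι => (σ : ι → ι)) h),
        fun σ => ⟨⟨σ, σ.bijective⟩, Equiv.ext fun _ => rfl⟩⟩)
  simp_rw [MultilinearMap.map_sum, MultilinearMap.map_smul_univ, smul_eq_mul]
  rw [sum_comm]
  simp_rw [← sum_mul, sum_prod_prod_erase_sign hodd, hterm]
  rw [← sum_filter, sum_const, hcard, nsmul_eq_mul]
  ring


/-- For odd `d ≥ 3` and a symmetric `d`-multilinear form `F` with associated polynomial
`f x = F (x,…,x)`, for any `x^1,…,x^d` there is a sign vector `β ∈ {−1,1}^d` with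
`f(∑_j (∏_{i≠j} β_i) x^j) ≥ d! · F(x^1,…,x^d)`. -/
theorem odd_degree_sign_choice (n d : ℕ) (hn : 1 ≤ n) (hd : 3 ≤ d) (hodd : Odd d)
    (F : MultilinearMap ℝ (fun _ : Fin d => (Fin n → ℝ)) ℝ)
    (hsym : ∀ (σ : Equiv.Perm (Fin d)) (x : Fin d → (Fin n → ℝ)),
      F (fun i => x (σ i)) = F x)
    (x : Fin d → (Fin n → ℝ)) :
    ∃ β : Fin d → Bool,
      (Nat.factorial d : ℝ) * F x ≤
        F (fun _ => ∑ j,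
          (∏ i ∈ Finset.univ.erase j, (if β i then (1 : ℝ) else -1)) • x j) := by
  have hsum := F.sum_map_sum_prod_erase_sign (by simpa using hodd) hsym x
  rw [Fintype.card_fin] at hsum
  obtain ⟨β, -, hβ⟩ := exists_le_of_sum_le (s := (univ : Finset (Fin d → Bool)))
    (f := fun _ => (Nat.factorial d : ℝ) * F x) univ_nonempty
    (by rw [hsum, sum_const]; simp)
  exact ⟨β, hβ⟩
end

section
/- Let d ≥ 4 be an even integer, n ≥ 1, p ∈ [2,∞], F : (ℝ^n)^d → ℝ a symmetric d-multilinear form, and f(x) = F(x,…,x). Let v_min = inf{ f(x) : x ∈ ℝ^n, ‖x‖_p ≤ 1 }. Then for any x^1,…,x^d ∈ ℝ^n with ‖x^i‖_p ≤ 1 for i = 1,…,d, there exists β = (β_1,…,β_d) ∈ {−1,1}^d with ∏_{i=1}^d β_i = 1 such that f((1/d)∑_{j=1}^d β_j x^j) − v_min ≥ (2·d!/d^d) · F(x^1,…,x^d). Moreover ‖(1/d)∑_{j=1}^d β_j x^j‖_p ≤ 1. -/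
open scoped ENNReal

/-- The `L_p` norm of a vector `x ∈ ℝ^ι`, for `p ∈ [1,∞]` (for `p = ∞`, the max norm). -/
noncomputable def lpNorm {ι : Type*} [Fintype ι] (p : ℝ≥0∞) (x : ι → ℝ) : ℝ :=
  if p = ∞ then ⨆ i, |x i| else (∑ i, |x i| ^ p.toReal) ^ (1 / p.toReal)

/-- The sign `1` or `-1` attached to a Boolean. -/
def boolSign (b : Bool) : ℝ := if b then 1 else -1

lemma boolSign_eq_one_or (b : Bool) : boolSign b = 1 ∨ boolSign b = -1 := by
  cases b <;> simp [boolSign]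

lemma prod_boolSign_eq_one_or {ι : Type*} (s : Finset ι) (β : ι → Bool) :
    ∏ i ∈ s, boolSign (β i) = 1 ∨ ∏ i ∈ s, boolSign (β i) = -1 := by
  classical
  induction s using Finset.induction_on with
  | empty => simp
  | insert a s ha ih =>
    rw [Finset.prod_insert ha]
    rcases ih with h | h <;> rcases boolSign_eq_one_or (β a) with h' | h' <;> simp [h, h']

lemma sum_prod_boolSign_pow {ι : Type*} [Fintype ι] [DecidableEq ι] (k : ι → ℕ) :
    ∑ β : ι → Bool, ∏ j, boolSign (β j) ^ k j = ∏ j, (1 + (-1) ^ k j) := by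
  have h := Finset.prod_univ_sum (fun _ : ι => (Finset.univ : Finset Bool))
    (fun j b => boolSign b ^ k j)
  rw [Fintype.piFinset_univ] at h
  rw [← h]
  simp [boolSign]

lemma sum_prod_boolSign_mul_prod_comp {ι : Type*} [Fintype ι] [DecidableEq ι] (r : ι → ι) :
    ∑ β : ι → Bool, (∏ j, boolSign (β j)) * ∏ i, boolSign (β (r i)) =
      if Function.Bijective r then 2 ^ Fintype.card ι else 0 := by
  split_ifs with hr
  · have h (β : ι → Bool) : (∏ j, boolSign (β j)) * ∏ i, boolSign (β (r i)) = 1 := by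
      rw [hr.prod_comp (fun j => boolSign (β j))]
      rcases prod_boolSign_eq_one_or Finset.univ β with h | h <;> simp [h]
    simp [h]
  · have hs : ¬ Function.Surjective r := fun h => hr (Finite.surjective_iff_bijective.mp h)
    obtain ⟨j, hj⟩ := not_forall.mp hs
    have h (β : ι → Bool) : (∏ j, boolSign (β j)) * ∏ i, boolSign (β (r i)) =
        ∏ j, boolSign (β j) ^ (1 + (Finset.univ.filter fun i => r i = j).card) := by
      rw [← Finset.prod_fiberwise' Finset.univ r (fun j => boolSign (β j)),
        ← Finset.prod_mul_distrib]
      simp [pow_add]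
    simp_rw [h]
    rw [sum_prod_boolSign_pow]
    refine Finset.prod_eq_zero (Finset.mem_univ j) ?_
    have : (Finset.univ.filter fun i => r i = j) = ∅ := by
      simpa [Finset.filter_eq_empty_iff] using hj
    simp [this]

lemma sum_prod_boolSign {ι : Type*} [Fintype ι] [DecidableEq ι] [Nonempty ι] :
    ∑ β : ι → Bool, ∏ j, boolSign (β j) = 0 := by
  have h := sum_prod_boolSign_pow (fun _ : ι => 1)
  simpa using h

/-- The polarization identity for symmetric multilinear forms. -/
lemma sum_prod_boolSign_mul_map_sum {ι E : Type*} [Fintype ι] [DecidableEq ι] [AddCommGroup E]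
    [Module ℝ E] (F : MultilinearMap ℝ (fun _ : ι => E) ℝ)
    (hsym : ∀ (σ : Equiv.Perm ι) (x : ι → E), F (fun i => x (σ i)) = F x) (x : ι → E) :
    ∑ β : ι → Bool, (∏ j, boolSign (β j)) * F (fun _ => ∑ j, boolSign (β j) • x j) =
      2 ^ Fintype.card ι * (Fintype.card ι).factorial * F x := by
  have hexp (β : ι → Bool) : F (fun _ => ∑ j, boolSign (β j) • x j) =
      ∑ r : ι → ι, (∏ i, boolSign (β (r i))) * F (fun i => x (r i)) := by
    rw [F.map_sum (fun _ j => boolSign (β j) • x j)]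
    exact Finset.sum_congr rfl fun r _ =>
      F.map_smul_univ (fun i => boolSign (β (r i))) (fun i => x (r i))
  simp_rw [hexp, Finset.mul_sum]
  rw [Finset.sum_comm]
  simp_rw [← mul_assoc, ← Finset.sum_mul, sum_prod_boolSign_mul_prod_comp]
  have hterm (r : ι → ι) :
      (if Function.Bijective r then (2 : ℝ) ^ Fintype.card ι else 0) * F (fun i => x (r i)) =
        if Function.Bijective r then 2 ^ Fintype.card ι * F x else 0 := by
    split_ifs with hr
    · rw [← hsym (Equiv.ofBijective r hr) x]
      rfl
    · simp
  simp_rw [hterm]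
  rw [← Finset.sum_filter, Finset.sum_const, nsmul_eq_mul]
  have hcard : (Finset.univ.filter fun r : ι → ι => Function.Bijective r).card =
      (Fintype.card ι).factorial := by
    rw [← Fintype.card_perm, ← Fintype.card_subtype]
    exact Fintype.card_congr (Equiv.ofBijective
      (fun σ : {r : ι → ι // Function.Bijective r} => Equiv.ofBijective σ.1 σ.2)
      ⟨fun a b h => Subtype.ext (congrArg (fun e : Equiv.Perm ι => (e : ι → ι)) h),
        fun σ => ⟨⟨σ, σ.bijective⟩, Equiv.ext fun _ => rfl⟩⟩)
  rw [hcard]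
  ring

lemma lpNorm_eq_norm_toLp {ι : Type*} [Fintype ι] (p : ℝ≥0∞) (hp : p ≠ 0) (x : ι → ℝ) :
    lpNorm p x = ‖WithLp.toLp p x‖ := by
  unfold lpNorm
  split_ifs with h
  · subst h
    simp [PiLp.norm_eq_ciSup]
  · rw [PiLp.norm_eq_sum (ENNReal.toReal_pos hp h)]
    simp

lemma bddBelow_diagonal_values {ι κ : Type*} [Fintype ι] [Fintype κ] (p : ℝ≥0∞) (hp : 1 ≤ p)
    (F : MultilinearMap ℝ (fun _ : κ => (ι → ℝ)) ℝ) :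
    BddBelow {v : ℝ | ∃ y : ι → ℝ, lpNorm p y ≤ 1 ∧ F (fun _ => y) = v} := by
  classical
  have : Fact (1 ≤ p) := ⟨hp⟩
  let e (r : κ → ι) : κ → ι → ℝ := fun i => Pi.single (r i) 1
  refine ⟨-∑ r : κ → ι, |F (e r)|, ?_⟩
  rintro _ ⟨y, hy, rfl⟩
  have hy' (i : ι) : |y i| ≤ 1 := by
    rw [lpNorm_eq_norm_toLp p (zero_lt_one.trans_le hp).ne'] at hy
    exact (PiLp.norm_apply_le (WithLp.toLp p y) i).trans hy
  have hexp : F (fun _ => y) = ∑ r : κ → ι, (∏ i, y (r i)) * F (e r) := by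
    have hsum : (fun _ : κ => y) = fun _ => ∑ j, y j • (Pi.single j 1 : ι → ℝ) := by
      ext k j
      simp [Finset.sum_apply, Pi.single_apply]
    rw [hsum, F.map_sum (fun _ j => y j • (Pi.single j 1 : ι → ℝ))]
    exact Finset.sum_congr rfl fun r _ => F.map_smul_univ (fun i => y (r i)) (e r)
  refine (abs_le.mp ?_).1
  rw [hexp]
  refine (Finset.abs_sum_le_sum_abs _ _).trans (Finset.sum_le_sum fun r _ => ?_)
  rw [abs_mul, Finset.abs_prod]
  exact mul_le_of_le_one_left (abs_nonneg _)
    (Finset.prod_le_one (fun _ _ => abs_nonneg _) fun i _ => hy' (r i))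

lemma lpNorm_signed_average_le {ι κ : Type*} [Fintype ι] [Fintype κ] (p : ℝ≥0∞) (hp : 1 ≤ p)
    (x : κ → ι → ℝ) (hx : ∀ i, lpNorm p (x i) ≤ 1) (β : κ → Bool) :
    lpNorm p ((Fintype.card κ : ℝ)⁻¹ • ∑ j, boolSign (β j) • x j) ≤ 1 := by
  have : Fact (1 ≤ p) := ⟨hp⟩
  simp only [lpNorm_eq_norm_toLp p (zero_lt_one.trans_le hp).ne'] at hx ⊢
  rw [WithLp.toLp_smul, WithLp.toLp_sum, norm_smul, norm_inv, RCLike.norm_natCast]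
  have hsum : ‖∑ j, WithLp.toLp p (boolSign (β j) • x j)‖ ≤ Fintype.card κ := by
    refine (norm_sum_le _ _).trans ?_
    calc ∑ j, ‖WithLp.toLp p (boolSign (β j) • x j)‖ ≤ ∑ _j : κ, (1 : ℝ) :=
          Finset.sum_le_sum fun j _ => by
            rw [WithLp.toLp_smul, norm_smul]
            rcases boolSign_eq_one_or (β j) with h | h <;> simpa [h] using hx j
      _ = Fintype.card κ := by simp
  exact inv_mul_le_one_of_le₀ hsum (Nat.cast_nonneg _)

/-- For even `d ≥ 4`, `p ∈ [2,∞]`, a symmetric `d`-multilinear form `F` with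
`f x = F (x,…,x)` and `v_min = inf { f x : ‖x‖_p ≤ 1 }`: for any `x^1,…,x^d` in the
unit `L_p`-ball there is `β ∈ {−1,1}^d` with `∏ β_i = 1` such that
`f((1/d) ∑_j β_j x^j) − v_min ≥ (2·d!/d^d) · F(x^1,…,x^d)`, and
`‖(1/d) ∑_j β_j x^j‖_p ≤ 1`. -/
theorem even_degree_sign_choice (n d : ℕ) (hn : 1 ≤ n) (hd : 4 ≤ d) (heven : Even d)
    (p : ℝ≥0∞) (hp : 2 ≤ p)
    (F : MultilinearMap ℝ (fun _ : Fin d => (Fin n → ℝ)) ℝ)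
    (hsym : ∀ (σ : Equiv.Perm (Fin d)) (x : Fin d → (Fin n → ℝ)),
      F (fun i => x (σ i)) = F x)
    (x : Fin d → (Fin n → ℝ)) (hx : ∀ i, lpNorm p (x i) ≤ 1) :
    ∃ β : Fin d → Bool,
      (∏ i, (if β i then (1 : ℝ) else -1)) = 1 ∧
      2 * (Nat.factorial d : ℝ) / (d : ℝ) ^ d * F x ≤
        F (fun _ => (d : ℝ)⁻¹ • ∑ j, (if β j then (1 : ℝ) else -1) • x j)
          - sInf {v : ℝ | ∃ y : Fin n → ℝ, lpNorm p y ≤ 1 ∧ F (fun _ => y) = v} ∧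
      lpNorm p ((d : ℝ)⁻¹ • ∑ j, (if β j then (1 : ℝ) else -1) • x j) ≤ 1 := by
  have hp1 : 1 ≤ p := le_trans (by norm_num) hp
  have hd0 : (0 : ℝ) < d := by exact_mod_cast (by omega : 0 < d)
  have : Nonempty (Fin d) := ⟨⟨0, by omega⟩⟩
  set v := sInf {v : ℝ | ∃ y : Fin n → ℝ, lpNorm p y ≤ 1 ∧ F (fun _ => y) = v}
  let y (β : Fin d → Bool) : Fin n → ℝ := (d : ℝ)⁻¹ • ∑ j, boolSign (β j) • x j
  have hy (β : Fin d → Bool) : lpNorm p (y β) ≤ 1 := by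
    simpa using lpNorm_signed_average_le p hp1 x hx β
  have hv (β : Fin d → Bool) : 0 ≤ F (fun _ => y β) - v :=
    sub_nonneg.mpr (csInf_le (bddBelow_diagonal_values p hp1 F) ⟨y β, hy β, rfl⟩)
  set c : ℝ := 2 * (Nat.factorial d : ℝ) / (d : ℝ) ^ d * F x with hc
  have hpolar : ∑ β : Fin d → Bool, (∏ j, boolSign (β j)) * (F (fun _ => y β) - v) =
      2 ^ d * (c / 2) := by
    have hscale (β : Fin d → Bool) : F (fun _ => y β) =
        ((d : ℝ)⁻¹) ^ d * F (fun _ => ∑ j, boolSign (β j) • x j) := by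
      simpa using F.map_smul_univ (fun _ => (d : ℝ)⁻¹) (fun _ => ∑ j, boolSign (β j) • x j)
    have h := sum_prod_boolSign_mul_map_sum F hsym x
    rw [Fintype.card_fin] at h
    simp_rw [mul_sub, Finset.sum_sub_distrib, ← Finset.sum_mul, sum_prod_boolSign, hscale,
      mul_left_comm _ (((d : ℝ)⁻¹) ^ d), ← Finset.mul_sum]
    rw [h, hc, inv_pow]
    ring
  have hsum : 0 ≤ ∑ β : Fin d → Bool,
      (1 + ∏ j, boolSign (β j)) * ((F (fun _ => y β) - v) - c) := by
    have hle : ∑ β : Fin d → Bool, (∏ j, boolSign (β j)) * (F (fun _ => y β) - v) ≤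
        ∑ β : Fin d → Bool, (F (fun _ => y β) - v) :=
      Finset.sum_le_sum fun β _ => mul_le_of_le_one_left (hv β) <| by
        rcases prod_boolSign_eq_one_or Finset.univ β with h | h <;> norm_num [h]
    have hsplit : ∑ β : Fin d → Bool,
        (1 + ∏ j, boolSign (β j)) * ((F (fun _ => y β) - v) - c) =
        ∑ β : Fin d → Bool, (F (fun _ => y β) - v) +
        ∑ β : Fin d → Bool, (∏ j, boolSign (β j)) * (F (fun _ => y β) - v) -
        2 ^ d * c - (∑ β : Fin d → Bool, ∏ j, boolSign (β j)) * c := by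
      have hconst : (2 : ℝ) ^ d * c = ∑ _β : Fin d → Bool, c := by simp
      rw [hconst, Finset.sum_mul, ← Finset.sum_add_distrib, ← Finset.sum_sub_distrib,
        ← Finset.sum_sub_distrib]
      exact Finset.sum_congr rfl fun β _ => by ring
    rw [hsplit, sum_prod_boolSign]
    linarith
  have hex : ∃ β : Fin d → Bool, ∏ j, boolSign (β j) = 1 ∧ c ≤ F (fun _ => y β) - v := by
    by_contra! hlt
    refine hsum.not_gt (Finset.sum_neg' (fun β _ => ?_) ⟨fun _ => true, Finset.mem_univ _, ?_⟩)
    · rcases prod_boolSign_eq_one_or Finset.univ β with h | h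
      · rw [h]
        linarith [hlt β h]
      · simp [h]
    · have h : ∏ j : Fin d, boolSign ((fun _ => true) j) = 1 := by simp [boolSign]
      rw [h]
      linarith [hlt _ h]
  obtain ⟨β, hβ, hcβ⟩ := hex
  exact ⟨β, hβ, hcβ, hy β⟩
end

section
/- Let A ∈ ℝ^{n_1×⋯×n_d} be an order-d tensor with symmetrization sym(A) ∈ ℝ^{N^d}, N = n_1+⋯+n_d. For i = 1,…,d let z^i ∈ ℝ^N have block decomposition z^i = (z^{i,(1)},…,z^{i,(d)}) with z^{i,(j)} ∈ ℝ^{n_j}. Then F_{sym(A)}(z^1,z^2,…,z^d) = ∑_{π ∈ S_d} F_A(z^{π(1),(1)}, z^{π(2),(2)}, …, z^{π(d),(d)}), where S_d is the set of all permutations of {1,…,d}. -/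
/-- The symmetrization `sym(A)` of an order-`d` tensor `A ∈ ℝ^{n_1 × ⋯ × n_d}`.
The index set of each slot of `sym(A)` is `Σ j, Fin (n j)` (i.e. `{1,…,N}` split into
blocks `B_1,…,B_d` with `|B_j| = n j`).  The `(χ_1,…,χ_d)`-block equals the
`χ`-transpose `A^χ` when `χ` is a permutation of `(1,…,d)`, and is zero otherwise. -/
noncomputable def symTensor {d : ℕ} {n : Fin d → ℕ}
    (A : ((j : Fin d) → Fin (n j)) → ℝ)
    (k : Fin d → (Σ j : Fin d, Fin (n j))) : ℝ :=
  ∑ σ : Equiv.Perm (Fin d),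
    if h : ∀ t, (k (σ t)).1 = t then
      A (fun t => Fin.cast (congrArg n (h t)) (k (σ t)).2)
    else 0

/-- The index of `sym(A)` whose slot `σ t` lies in block `t` and carries the entry `i t`. -/
def blockIndex {d : ℕ} {n : Fin d → ℕ} (σ : Equiv.Perm (Fin d))
    (i : (j : Fin d) → Fin (n j)) (s : Fin d) : Σ j : Fin d, Fin (n j) :=
  ⟨σ.symm s, i (σ.symm s)⟩

theorem blockIndex_apply {d : ℕ} {n : Fin d → ℕ} (σ : Equiv.Perm (Fin d))
    (i : (j : Fin d) → Fin (n j)) (t : Fin d) : blockIndex σ i (σ t) = ⟨t, i t⟩ := by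
  rw [blockIndex, Equiv.symm_apply_apply]

theorem blockIndex_injective {d : ℕ} {n : Fin d → ℕ} (σ : Equiv.Perm (Fin d)) :
    Function.Injective (blockIndex (n := n) σ) := by
  intro i i' h
  funext t
  have ht := congrFun h (σ t)
  rw [blockIndex_apply, blockIndex_apply] at ht
  exact eq_of_heq (Sigma.mk.inj ht).2

theorem cast_snd_of_eq {d : ℕ} {n : Fin d → ℕ} {t : Fin d} {x : Σ j : Fin d, Fin (n j)}
    {a : Fin (n t)} (hx : x = ⟨t, a⟩) (h : x.1 = t) :
    Fin.cast (congrArg n h) x.2 = a := by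
  subst hx
  rfl

theorem mk_cast_snd {d : ℕ} {n : Fin d → ℕ} {t : Fin d} (x : Σ j : Fin d, Fin (n j))
    (h : x.1 = t) : (⟨t, Fin.cast (congrArg n h) x.2⟩ : Σ j : Fin d, Fin (n j)) = x := by
  subst h
  rfl

theorem mem_range_blockIndex {d : ℕ} {n : Fin d → ℕ} (σ : Equiv.Perm (Fin d))
    {k : Fin d → (Σ j : Fin d, Fin (n j))} (h : ∀ t, (k (σ t)).1 = t) :
    k ∈ Set.range (blockIndex (n := n) σ) := by
  refine ⟨fun t => Fin.cast (congrArg n (h t)) (k (σ t)).2, funext fun s => ?_⟩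
  obtain ⟨t, rfl⟩ := σ.surjective s
  rw [blockIndex_apply]
  exact mk_cast_snd _ (h t)

/-- `F_{sym(A)}(z^1,…,z^d) = ∑_{π ∈ S_d} F_A(z^{π(1),(1)}, …, z^{π(d),(d)})`, where
`z^{i,(j)}` is the `j`-th block of `z^i ∈ ℝ^N`. -/
theorem multilinear_form_of_symmetrization (d : ℕ) (hd : 2 ≤ d) (n : Fin d → ℕ)
    (A : ((j : Fin d) → Fin (n j)) → ℝ)
    (z : Fin d → ((Σ j : Fin d, Fin (n j)) → ℝ)) :
    (∑ k : Fin d → (Σ j : Fin d, Fin (n j)), symTensor A k * ∏ s, z s (k s))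
      = ∑ π : Equiv.Perm (Fin d),
          ∑ i : (j : Fin d) → Fin (n j), A i * ∏ j, z (π j) ⟨j, i j⟩ := by
  simp only [symTensor, Finset.sum_mul]
  rw [Finset.sum_comm]
  refine Finset.sum_congr rfl fun σ _ => ?_
  symm
  refine Fintype.sum_of_injective (blockIndex σ) (blockIndex_injective σ) _ _ ?_ ?_
  · intro k hk
    rw [dif_neg fun h => hk (mem_range_blockIndex σ h), zero_mul]
  · intro i
    have h : ∀ t, (blockIndex σ i (σ t)).1 = t := fun t => by rw [blockIndex_apply]
    rw [dif_pos h, ← Equiv.prod_comp σ fun s => z s (blockIndex σ i s)]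
    refine congrArg₂ _ ?_ ?_
    · exact congrArg A (funext fun t => (cast_snd_of_eq (blockIndex_apply σ i t) (h t)).symm)
    · simp only [blockIndex_apply]
end

section
/- Let d ≥ 2, p ∈ [2,∞], and let A ∈ ℝ^{n_1×⋯×n_d} be a non-zero order-d tensor with symmetrization sym(A) ∈ ℝ^{N^d}, N = n_1+⋯+n_d. Then sup{ f_{sym(A)}(z) : z ∈ ℝ^N, ‖z‖_p ≤ d^{1/p} } = d! · sup{ F_A(x^1,…,x^d) : x^i ∈ ℝ^{n_i}, ‖x^i‖_p ≤ 1 for i = 1,…,d }. -/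
open scoped ENNReal

lemma lpNorm_nonneg {ι : Type*} [Fintype ι] (p : ℝ≥0∞) (x : ι → ℝ) : 0 ≤ lpNorm p x := by
  unfold lpNorm
  split_ifs
  · exact Real.iSup_nonneg fun i => abs_nonneg _
  · positivity

lemma lpNorm_top {ι : Type*} [Fintype ι] (x : ι → ℝ) : lpNorm ∞ x = ⨆ i, |x i| := if_pos rfl

lemma lpNorm_rpow {ι : Type*} [Fintype ι] {p : ℝ≥0∞} (hp : p ≠ ∞) (hp' : 0 < p.toReal)
    (x : ι → ℝ) : lpNorm p x ^ p.toReal = ∑ i, |x i| ^ p.toReal := by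
  rw [lpNorm, if_neg hp, one_div, Real.rpow_inv_rpow (by positivity) hp'.ne']

lemma abs_le_lpNorm {ι : Type*} [Fintype ι] {p : ℝ≥0∞} (hp : 0 < p) (x : ι → ℝ) (i : ι) :
    |x i| ≤ lpNorm p x := by
  by_cases h : p = ∞
  · subst h
    rw [lpNorm_top]
    exact le_ciSup (f := fun i => |x i|) (Set.finite_range _).bddAbove i
  · have hp' := ENNReal.toReal_pos hp.ne' h
    rw [← Real.rpow_le_rpow_iff (abs_nonneg _) (lpNorm_nonneg p x) hp', lpNorm_rpow h hp']
    exact Finset.single_le_sum (f := fun i => |x i| ^ p.toReal) (fun _ _ => by positivity)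
      (Finset.mem_univ i)

lemma lpNorm_smul {ι : Type*} [Fintype ι] {p : ℝ≥0∞} (hp : 0 < p) (c : ℝ) (x : ι → ℝ) :
    lpNorm p (c • x) = |c| * lpNorm p x := by
  by_cases h : p = ∞
  · subst h
    simp only [lpNorm_top, Pi.smul_apply, smul_eq_mul, abs_mul]
    exact (Real.mul_iSup_of_nonneg (abs_nonneg c) _).symm
  · have hp' := ENNReal.toReal_pos hp.ne' h
    rw [← Real.rpow_left_inj (lpNorm_nonneg _ _)
      (mul_nonneg (abs_nonneg c) (lpNorm_nonneg _ _)) hp'.ne',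
      Real.mul_rpow (abs_nonneg c) (lpNorm_nonneg _ _), lpNorm_rpow h hp', lpNorm_rpow h hp',
      Finset.mul_sum]
    exact Finset.sum_congr rfl fun i _ => by
      rw [Pi.smul_apply, smul_eq_mul, abs_mul, Real.mul_rpow (abs_nonneg _) (abs_nonneg _)]

lemma lpNorm_zero {ι : Type*} [Fintype ι] {p : ℝ≥0∞} (hp : 0 < p) :
    lpNorm p (0 : ι → ℝ) = 0 := by
  simpa using lpNorm_smul hp 0 (0 : ι → ℝ)

lemma lpNorm_sigma_rpow {d : ℕ} {n : Fin d → ℕ} {p : ℝ≥0∞} (hp : p ≠ ∞) (hp' : 0 < p.toReal)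
    (z : (Σ j : Fin d, Fin (n j)) → ℝ) :
    lpNorm p z ^ p.toReal = ∑ j, lpNorm p (fun i => z ⟨j, i⟩) ^ p.toReal := by
  simp only [lpNorm_rpow hp hp', Fintype.sum_sigma]

lemma lpNorm_le_rpow_iff {ι : Type*} [Fintype ι] {p : ℝ≥0∞} (hp' : 0 < p.toReal)
    (x : ι → ℝ) {c : ℝ} (hc : 0 ≤ c) :
    lpNorm p x ≤ c ^ (1 / p.toReal) ↔ lpNorm p x ^ p.toReal ≤ c := by
  rw [one_div, Real.le_rpow_inv_iff_of_pos (lpNorm_nonneg p x) hc hp']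

/-- A concatenation of `d` vectors in the unit ball lies in the ball of radius `d^{1/p}`. -/
lemma lpNorm_sigma_le {d : ℕ} {n : Fin d → ℕ} {p : ℝ≥0∞} (hp : 0 < p)
    (z : (Σ j : Fin d, Fin (n j)) → ℝ) (hz : ∀ j, lpNorm p (fun i => z ⟨j, i⟩) ≤ 1) :
    lpNorm p z ≤ if p = ∞ then 1 else (d : ℝ) ^ (1 / p.toReal) := by
  split_ifs with h
  · subst h
    rw [lpNorm_top]
    exact Real.iSup_le (fun k => (abs_le_lpNorm hp (fun i => z ⟨k.1, i⟩) k.2).trans (hz k.1))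
      zero_le_one
  · have hp' := ENNReal.toReal_pos hp.ne' h
    rw [lpNorm_le_rpow_iff hp' z d.cast_nonneg, lpNorm_sigma_rpow h hp']
    calc ∑ j, lpNorm p (fun i => z ⟨j, i⟩) ^ p.toReal ≤ ∑ _j : Fin d, (1 : ℝ) :=
          Finset.sum_le_sum fun j _ => Real.rpow_le_one (lpNorm_nonneg _ _) (hz j) hp'.le
      _ = d := by simp

lemma prod_le_one_of_sum_le_card {ι : Type*} [Fintype ι] {a : ι → ℝ} (ha : ∀ i, 0 ≤ a i)
    (h : ∑ i, a i ≤ Fintype.card ι) : ∏ i, a i ≤ 1 :=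
  calc ∏ i, a i ≤ ∏ i, Real.exp (a i - 1) :=
        Finset.prod_le_prod (fun i _ => ha i) fun i _ => by
          linarith [Real.add_one_le_exp (a i - 1)]
    _ = Real.exp (∑ i, (a i - 1)) := (Real.exp_sum _ _).symm
    _ ≤ 1 := Real.exp_le_one_iff.2 (by simpa using h)

lemma prod_lpNorm_le_one {d : ℕ} {n : Fin d → ℕ} {p : ℝ≥0∞} (hp : 0 < p)
    (z : (Σ j : Fin d, Fin (n j)) → ℝ)
    (hz : lpNorm p z ≤ if p = ∞ then 1 else (d : ℝ) ^ (1 / p.toReal)) :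
    ∏ j, lpNorm p (fun i => z ⟨j, i⟩) ≤ 1 := by
  split_ifs at hz with h
  · subst h
    refine Finset.prod_le_one (fun j _ => lpNorm_nonneg _ _) fun j _ => ?_
    rw [lpNorm_top]
    exact Real.iSup_le (fun i => (abs_le_lpNorm hp z ⟨j, i⟩).trans hz) zero_le_one
  · have hp' := ENNReal.toReal_pos hp.ne' h
    rw [lpNorm_le_rpow_iff hp' z d.cast_nonneg, lpNorm_sigma_rpow h hp'] at hz
    have := prod_le_one_of_sum_le_card
      (fun j => Real.rpow_nonneg (lpNorm_nonneg p fun i => z ⟨j, i⟩) p.toReal) (by simpa using hz)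
    rw [Real.finsetProd_rpow _ _ fun j _ => lpNorm_nonneg _ _] at this
    by_contra! hlt
    exact absurd this (not_le.2 (Real.one_lt_rpow hlt hp'))

lemma multilinear_smul {d : ℕ} {n : Fin d → ℕ} (A : ((j : Fin d) → Fin (n j)) → ℝ)
    (c : Fin d → ℝ) (x : (j : Fin d) → (Fin (n j) → ℝ)) :
    ∑ i : (j : Fin d) → Fin (n j), A i * ∏ j, (c j • x j) (i j) =
      (∏ j, c j) * ∑ i : (j : Fin d) → Fin (n j), A i * ∏ j, x j (i j) := by
  simp only [Pi.smul_apply, smul_eq_mul, Finset.prod_mul_distrib, Finset.mul_sum]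
  exact Finset.sum_congr rfl fun i _ => by ring

lemma multilinear_le_sum_abs {d : ℕ} {n : Fin d → ℕ} {p : ℝ≥0∞} (hp : 0 < p)
    (A : ((j : Fin d) → Fin (n j)) → ℝ) (x : (j : Fin d) → (Fin (n j) → ℝ))
    (hx : ∀ j, lpNorm p (x j) ≤ 1) :
    ∑ i : (j : Fin d) → Fin (n j), A i * ∏ j, x j (i j) ≤ ∑ i, |A i| := by
  refine Finset.sum_le_sum fun i _ => (le_abs_self _).trans ?_
  rw [abs_mul, Finset.abs_prod]
  exact mul_le_of_le_one_right (abs_nonneg _) (Finset.prod_le_one (fun _ _ => abs_nonneg _)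
    fun j _ => (abs_le_lpNorm hp (x j) (i j)).trans (hx j))

/-- A bound on the unit balls extends to all vectors by homogeneity. -/
lemma multilinear_le_prod_lpNorm_mul {d : ℕ} {n : Fin d → ℕ} {p : ℝ≥0∞} (hp : 0 < p)
    (A : ((j : Fin d) → Fin (n j)) → ℝ) {M : ℝ}
    (hM : ∀ x : (j : Fin d) → (Fin (n j) → ℝ), (∀ j, lpNorm p (x j) ≤ 1) →
      ∑ i : (j : Fin d) → Fin (n j), A i * ∏ j, x j (i j) ≤ M)
    (x : (j : Fin d) → (Fin (n j) → ℝ)) :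
    ∑ i : (j : Fin d) → Fin (n j), A i * ∏ j, x j (i j) ≤ (∏ j, lpNorm p (x j)) * M := by
  have hx : x = fun j => lpNorm p (x j) • ((lpNorm p (x j))⁻¹ • x j) := by
    funext j
    by_cases h : lpNorm p (x j) = 0
    · ext i
      have := abs_le_lpNorm hp (x j) i
      rw [h] at this
      simpa [h] using this
    · rw [smul_inv_smul₀ h]
  conv_lhs => rw [hx]
  rw [multilinear_smul]
  refine mul_le_mul_of_nonneg_left (hM _ fun j => ?_)
    (Finset.prod_nonneg fun j _ => lpNorm_nonneg _ _)
  rw [lpNorm_smul hp, abs_inv, abs_of_nonneg (lpNorm_nonneg _ _)]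
  exact inv_mul_le_one

lemma sigma_mk_cast_eq {d : ℕ} {n : Fin d → ℕ} (y : Σ j : Fin d, Fin (n j)) {t : Fin d}
    (h : y.1 = t) : (⟨t, Fin.cast (congrArg n h) y.2⟩ : Σ j : Fin d, Fin (n j)) = y := by
  subst h
  rfl

lemma cast_apply_eq {d : ℕ} {n : Fin d → ℕ} (i : (j : Fin d) → Fin (n j)) {s t : Fin d}
    (h : s = t) : Fin.cast (congrArg n h) (i s) = i t := by
  subst h
  rfl

/-- The polynomial of the symmetrization is `d!` times the multilinear form on the blocks. -/
lemma sum_symTensor_mul_prod {d : ℕ} {n : Fin d → ℕ} (A : ((j : Fin d) → Fin (n j)) → ℝ)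
    (z : (Σ j : Fin d, Fin (n j)) → ℝ) :
    ∑ k : Fin d → (Σ j : Fin d, Fin (n j)), symTensor A k * ∏ s, z (k s) =
      (Nat.factorial d : ℝ) * ∑ i : (j : Fin d) → Fin (n j), A i * ∏ j, z ⟨j, i j⟩ := by
  have key (σ : Equiv.Perm (Fin d)) :
      ∑ k : Fin d → (Σ j : Fin d, Fin (n j)),
        (if h : ∀ t, (k (σ t)).1 = t then
          A (fun t => Fin.cast (congrArg n (h t)) (k (σ t)).2) else 0) * ∏ s, z (k s) =
      ∑ i : (j : Fin d) → Fin (n j), A i * ∏ j, z ⟨j, i j⟩ := by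
    symm
    refine Finset.sum_of_injOn (fun i s => ⟨σ.symm s, i (σ.symm s)⟩) ?_ (by simp) ?_ ?_
    · intro i _ i' _ h
      funext t
      obtain ⟨s, rfl⟩ := σ.symm.surjective t
      exact eq_of_heq (Sigma.mk.inj (congrFun h s)).2
    · intro k _ hk
      rw [dif_neg, zero_mul]
      intro h
      refine hk ⟨fun t => Fin.cast (congrArg n (h t)) (k (σ t)).2,
        Finset.mem_coe.2 (Finset.mem_univ _), ?_⟩
      funext s
      exact (sigma_mk_cast_eq (k (σ (σ.symm s))) (h _)).trans (by rw [σ.apply_symm_apply])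
    · intro i _
      have h : ∀ t, σ.symm (σ t) = t := σ.symm_apply_apply
      rw [dif_pos h]
      congr 1
      · congr 1
        funext t
        exact (cast_apply_eq i (h t)).symm
      · exact (Equiv.prod_comp σ.symm fun t => z ⟨t, i t⟩).symm
  simp only [symTensor, Finset.sum_mul]
  rw [Finset.sum_comm, Finset.sum_congr rfl fun σ _ => key σ]
  simp [Fintype.card_perm]

/-- `sup{ f_{sym(A)}(z) : ‖z‖_p ≤ d^{1/p} } = d! · sup{ F_A(x^1,…,x^d) : ‖x^i‖_p ≤ 1 }`
for any non-zero order-`d` tensor `A` and `p ∈ [2,∞]` (with `d^{1/p} = 1` for `p = ∞`). -/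
theorem sup_sym_eq_factorial_mul_sup_multilinear (d : ℕ) (hd : 2 ≤ d)
    (p : ℝ≥0∞) (hp : 2 ≤ p) (n : Fin d → ℕ)
    (A : ((j : Fin d) → Fin (n j)) → ℝ) (hA : A ≠ 0) :
    sSup {v : ℝ | ∃ z : (Σ j : Fin d, Fin (n j)) → ℝ,
        lpNorm p z ≤ (if p = ∞ then 1 else (d : ℝ) ^ (1 / p.toReal)) ∧
        (∑ k : Fin d → (Σ j : Fin d, Fin (n j)), symTensor A k * ∏ s, z (k s)) = v}
      = (Nat.factorial d : ℝ) *
        sSup {v : ℝ | ∃ x : (j : Fin d) → (Fin (n j) → ℝ),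
          (∀ j, lpNorm p (x j) ≤ 1) ∧
          (∑ i : (j : Fin d) → Fin (n j), A i * ∏ j, x j (i j)) = v} := by
  have hp0 : 0 < p := two_pos.trans_le hp
  simp only [sum_symTensor_mul_prod]
  set S := {v : ℝ | ∃ x : (j : Fin d) → (Fin (n j) → ℝ), (∀ j, lpNorm p (x j) ≤ 1) ∧
    (∑ i : (j : Fin d) → Fin (n j), A i * ∏ j, x j (i j)) = v}
  have hbdd : BddAbove S := by
    refine ⟨∑ i, |A i|, ?_⟩
    rintro _ ⟨x, hx, rfl⟩
    exact multilinear_le_sum_abs hp0 A x hx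
  have hM (x : (j : Fin d) → (Fin (n j) → ℝ)) (hx : ∀ j, lpNorm p (x j) ≤ 1) :
      ∑ i : (j : Fin d) → Fin (n j), A i * ∏ j, x j (i j) ≤ sSup S :=
    le_csSup hbdd ⟨x, hx, rfl⟩
  have hzero : ∀ j, lpNorm p (0 : Fin (n j) → ℝ) ≤ 1 := fun j =>
    (lpNorm_zero hp0).trans_le zero_le_one
  have hM0 : 0 ≤ sSup S := by
    have hd0 : d ≠ 0 := by omega
    simpa [hd0] using hM 0 hzero
  refine IsLUB.csSup_eq ⟨?_, fun b hb => ?_⟩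
    ⟨_, fun k => (0 : Fin (n k.1) → ℝ) k.2, lpNorm_sigma_le hp0 _ hzero, rfl⟩
  · rintro _ ⟨z, hz, rfl⟩
    refine mul_le_mul_of_nonneg_left ?_ (Nat.cast_nonneg _)
    exact (multilinear_le_prod_lpNorm_mul hp0 A hM fun j i => z ⟨j, i⟩).trans
      (mul_le_of_le_one_left hM0 (prod_lpNorm_le_one hp0 z hz))
  · have hd0 : (0 : ℝ) < Nat.factorial d := by positivity
    rw [← le_div_iff₀' hd0]
    refine csSup_le ⟨_, 0, hzero, rfl⟩ ?_
    rintro _ ⟨x, hx, rfl⟩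
    rw [le_div_iff₀' hd0]
    exact hb ⟨fun k => x k.1 k.2, lpNorm_sigma_le hp0 _ hx, rfl⟩
end

section
/- Let d ≥ 3 and n be integers with 2 ≤ n ≤ d, and let p ∈ [2,∞) be a real number. Then for every x = (x_1,…,x_n) ∈ [0,d]^n, ∑_{i=1}^n x_i^{1/p} ∏_{j≠i} (d−x_j)^{1/p} ≤ d^{n/p} · n^{1−1/p} · (1−1/n)^{(n−1)/p}, and the right-hand side equals the value of the left-hand side at x_1 = ⋯ = x_n = d/n. -/
theorem one_add_sum_le_prod_one_add_of_nonneg {ι : Type*} (s : Finset ι) {y : ι → ℝ}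
    (hy : ∀ i ∈ s, 0 ≤ y i) : 1 + ∑ i ∈ s, y i ≤ ∏ i ∈ s, (1 + y i) := by
  classical
  induction s using Finset.induction_on with
  | empty => simp
  | insert a s ha ih =>
    rw [Finset.sum_insert ha, Finset.prod_insert ha]
    have hs : ∀ i ∈ s, 0 ≤ y i := fun i hi => hy i (Finset.mem_insert_of_mem hi)
    have hsum : 0 ≤ ∑ i ∈ s, y i := Finset.sum_nonneg hs
    nlinarith [ih hs, hy a (Finset.mem_insert_self a s)]

theorem one_add_sum_le_prod_one_add_of_nonpos {ι : Type*} (s : Finset ι) {y : ι → ℝ}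
    (hy : ∀ i ∈ s, -1 ≤ y i) (hy' : ∀ i ∈ s, y i ≤ 0) :
    1 + ∑ i ∈ s, y i ≤ ∏ i ∈ s, (1 + y i) := by
  classical
  induction s using Finset.induction_on with
  | empty => simp
  | insert a s ha ih =>
    rw [Finset.sum_insert ha, Finset.prod_insert ha]
    have hs : ∀ i ∈ s, -1 ≤ y i := fun i hi => hy i (Finset.mem_insert_of_mem hi)
    have hs' : ∀ i ∈ s, y i ≤ 0 := fun i hi => hy' i (Finset.mem_insert_of_mem hi)
    have hprod : ∏ i ∈ s, (1 + y i) ≤ 1 :=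
      Finset.prod_le_one (fun i hi => by linarith [hs i hi]) (fun i hi => by linarith [hs' i hi])
    nlinarith [ih hs hs', hy' a (Finset.mem_insert_self a s)]

/-- Normalised form of `n ^ (n - 2) * (∑ i, x i) ^ 2 ≤ ∏ i, (x i ^ 2 + n - 1)`. -/
theorem sq_mean_le_prod_one_add {ι : Type*} [Fintype ι] [Nonempty ι] (x : ι → ℝ) :
    ((∑ i, x i) / Fintype.card ι) ^ 2 ≤ ∏ i, (1 + (x i ^ 2 - 1) / Fintype.card ι) := by
  classical
  have hn : (1 : ℝ) ≤ Fintype.card ι := by exact_mod_cast Fintype.card_pos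
  set n : ℝ := (Fintype.card ι : ℝ) with hn_def
  have hn0 : 0 < n := by linarith
  set f : ι → ℝ := fun i => if 1 ≤ x i ^ 2 then x i else 1 with hf
  set g : ι → ℝ := fun i => if 1 ≤ x i ^ 2 then 1 else x i with hg
  have hfg : ∀ i, f i * g i = x i := fun i => by simp only [hf, hg]; split_ifs <;> simp
  have hmean : ∀ h : ι → ℝ, 1 + ∑ i, (h i ^ 2 - 1) / n = (∑ i, h i ^ 2) / n := fun h => by
    rw [← Finset.sum_div, Finset.sum_sub_distrib]
    simp only [Finset.sum_const, Finset.card_univ, nsmul_eq_mul, mul_one, ← hn_def]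
    field_simp
    ring
  have hF : (∑ i, f i ^ 2) / n ≤ ∏ i, (1 + (f i ^ 2 - 1) / n) := by
    rw [← hmean]
    refine one_add_sum_le_prod_one_add_of_nonneg _ fun i _ => div_nonneg ?_ hn0.le
    simp only [hf]
    split_ifs <;> linarith
  have hG : (∑ i, g i ^ 2) / n ≤ ∏ i, (1 + (g i ^ 2 - 1) / n) := by
    rw [← hmean]
    refine one_add_sum_le_prod_one_add_of_nonpos _ (fun i _ => ?_) fun i _ =>
      div_nonpos_of_nonpos_of_nonneg ?_ hn0.le
    · rw [le_div_iff₀ hn0]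
      nlinarith [sq_nonneg (g i)]
    · simp only [hg]
      split_ifs <;> linarith
  calc ((∑ i, x i) / n) ^ 2 = (∑ i, f i * g i) ^ 2 / n ^ 2 := by simp only [hfg, div_pow]
    _ ≤ ((∑ i, f i ^ 2) * ∑ i, g i ^ 2) / n ^ 2 := by
      gcongr
      exact Finset.sum_mul_sq_le_sq_mul_sq _ f g
    _ = (∑ i, f i ^ 2) / n * ((∑ i, g i ^ 2) / n) := by ring
    _ ≤ (∏ i, (1 + (f i ^ 2 - 1) / n)) * ∏ i, (1 + (g i ^ 2 - 1) / n) :=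
      mul_le_mul hF hG (by positivity) (le_trans (by positivity) hF)
    _ = ∏ i, (1 + (x i ^ 2 - 1) / n) := by
      rw [← Finset.prod_mul_distrib]
      refine Finset.prod_congr rfl fun i _ => ?_
      simp only [hf, hg]
      split_ifs <;> ring

theorem one_le_card_mul_one_sub_inv_pow {n : ℕ} (hn : 1 ≤ n) :
    1 ≤ (n : ℝ) * (1 - 1 / n) ^ (n - 1) := by
  have hn1 : (1 : ℝ) ≤ n := by exact_mod_cast hn
  have h := one_add_mul_le_pow (a := -(1 / (n : ℝ)))
    (by have : 1 / (n : ℝ) ≤ 1 := by rw [div_le_one] <;> linarith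
        linarith) (n - 1)
  rw [Nat.cast_sub hn, ← sub_eq_add_neg] at h
  calc (1 : ℝ) = n * (1 + ((n : ℝ) - (1 : ℕ)) * -(1 / (n : ℝ))) := by
        push_cast; field_simp; ring
    _ ≤ _ := by gcongr

/-- The case `p = 2`, with the variables rescaled to the unit cube. -/
theorem sq_sum_sqrt_mul_prod_erase_le {n : ℕ} (hn : 2 ≤ n) {t : Fin n → ℝ}
    (ht : ∀ i, t i ∈ Set.Icc (0 : ℝ) 1) :
    (∑ i, √(t i * ∏ j ∈ Finset.univ.erase i, (1 - t j))) ^ 2 ≤ n * (1 - 1 / n) ^ (n - 1) := by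
  have hn2 : (2 : ℝ) ≤ n := by exact_mod_cast hn
  have : Nonempty (Fin n) := ⟨⟨0, by omega⟩⟩
  by_cases h : ∃ k, t k = 1
  · obtain ⟨k, hk⟩ := h
    rw [Finset.sum_eq_single k]
    · rw [Real.sq_sqrt, hk, one_mul]
      · refine le_trans ?_ (one_le_card_mul_one_sub_inv_pow (by omega))
        exact Finset.prod_le_one (fun j _ => by linarith [(ht j).2])
          (fun j _ => by linarith [(ht j).1])
      · exact mul_nonneg (ht k).1 (Finset.prod_nonneg fun j _ => by linarith [(ht j).2])
    · intro i _ hik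
      rw [Finset.prod_eq_zero (Finset.mem_erase.2 ⟨hik.symm, Finset.mem_univ k⟩) (by simp [hk])]
      simp
    · simp
  · push Not at h
    have hpos : ∀ i, 0 < 1 - t i := fun i => by
      linarith [lt_of_le_of_ne (ht i).2 (h i)]
    set P := ∏ j, (1 - t j) with hP
    have hP0 : 0 < P := Finset.prod_pos fun j _ => hpos j
    set a : Fin n → ℝ := fun i => t i * ∏ j ∈ Finset.univ.erase i, (1 - t j) with ha
    have ha0 : ∀ i, 0 ≤ a i := fun i =>
      mul_nonneg (ht i).1 (Finset.prod_nonneg fun j _ => (hpos j).le)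
    have haP : ∀ i, a i * (1 - t i) = t i * P := fun i => by
      rw [hP, ← Finset.mul_prod_erase _ _ (Finset.mem_univ i)]
      simp only [ha]
      ring
    have hK : 0 ≤ ((n : ℝ) - 1) / P := div_nonneg (by linarith) hP0.le
    have key := sq_mean_le_prod_one_add fun i => √(((n : ℝ) - 1) / P) * √(a i)
    have hfac : ∀ i, 1 + ((√(((n : ℝ) - 1) / P) * √(a i)) ^ 2 - 1) / n
        = (1 - 1 / n) / (1 - t i) := fun i => by
      have hi := (hpos i).ne'
      have hai : a i = t i * P / (1 - t i) := by rw [eq_div_iff hi, haP]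
      rw [mul_pow, Real.sq_sqrt hK, Real.sq_sqrt (ha0 i), hai]
      field_simp
      ring
    simp only [Fintype.card_fin, hfac] at key
    rw [Finset.prod_div_distrib, ← hP, ← Finset.mul_sum, div_pow, mul_pow, Real.sq_sqrt hK,
      Finset.prod_const, Finset.card_univ, Fintype.card_fin,
      ← pow_sub_one_mul (show n ≠ 0 by omega)] at key
    set S := (∑ i, √(a i)) ^ 2
    set Q := (1 - 1 / (n : ℝ)) ^ (n - 1)
    have hn1 : 0 < (n : ℝ) - 1 := by linarith
    have hc : 0 < ((n : ℝ) - 1) / (P * n ^ 2) := by positivity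
    refine le_of_mul_le_mul_left ?_ hc
    calc _ = ((n : ℝ) - 1) / P * S / n ^ 2 := by field_simp
      _ ≤ _ := key
      _ = _ := by field_simp

theorem sum_rpow_mul_prod_erase_le {n : ℕ} (hn : 2 ≤ n) {t : Fin n → ℝ}
    (ht : ∀ i, t i ∈ Set.Icc (0 : ℝ) 1) {p : ℝ} (hp : 2 ≤ p) :
    ∑ i, (t i * ∏ j ∈ Finset.univ.erase i, (1 - t j)) ^ (1 / p)
      ≤ n * (1 / n * (1 - 1 / n) ^ (n - 1) : ℝ) ^ (1 / p) := by
  have hn2 : (2 : ℝ) ≤ n := by exact_mod_cast hn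
  have hn0 : (0 : ℝ) < n := by linarith
  have hp0 : 0 < p := by linarith
  have key := sq_sum_sqrt_mul_prod_erase_le hn ht
  set a : Fin n → ℝ := fun i => t i * ∏ j ∈ Finset.univ.erase i, (1 - t j) with ha
  have ha0 : ∀ i, 0 ≤ a i := fun i =>
    mul_nonneg (ht i).1 (Finset.prod_nonneg fun j _ => by linarith [(ht j).2])
  have hmean := Real.rpow_arith_mean_le_arith_mean_rpow Finset.univ (fun _ : Fin n => 1 / (n : ℝ))
    (fun i => a i ^ (1 / p)) (fun _ _ => by positivity) (by simp; field_simp)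
    (fun i _ => Real.rpow_nonneg (ha0 i) _) (p := p / 2) (by linarith)
  have hsqrt : ∀ i, (a i ^ (1 / p)) ^ (p / 2) = √(a i) := fun i => by
    rw [← Real.rpow_mul (ha0 i), Real.sqrt_eq_rpow]
    congr 1
    field_simp
  simp only [hsqrt, ← Finset.mul_sum] at hmean
  set T := ∑ i, a i ^ (1 / p)
  have hT : 0 ≤ T := Finset.sum_nonneg fun i _ => Real.rpow_nonneg (ha0 i) _
  have hTn : 0 ≤ 1 / (n : ℝ) * T := by positivity
  have hpow : (1 / (n : ℝ) * T) ^ p ≤ 1 / n * (1 - 1 / n) ^ (n - 1) := by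
    calc (1 / (n : ℝ) * T) ^ p = ((1 / (n : ℝ) * T) ^ (p / 2)) ^ 2 := by
          rw [← Real.rpow_mul_natCast hTn]
          congr 1
          push_cast
          ring
      _ ≤ (1 / (n : ℝ) * ∑ i, √(a i)) ^ 2 := by gcongr
      _ = (1 / (n : ℝ)) ^ 2 * (∑ i, √(a i)) ^ 2 := by ring
      _ ≤ (1 / (n : ℝ)) ^ 2 * (n * (1 - 1 / n) ^ (n - 1)) := by gcongr
      _ = _ := by field_simp
  have hroot : 1 / (n : ℝ) * T ≤ (1 / n * (1 - 1 / n) ^ (n - 1) : ℝ) ^ (1 / p) := by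
    calc 1 / (n : ℝ) * T = ((1 / (n : ℝ) * T) ^ p) ^ (1 / p) := by
          rw [← Real.rpow_mul hTn, mul_one_div_cancel hp0.ne', Real.rpow_one]
      _ ≤ _ := Real.rpow_le_rpow (by positivity) hpow (by positivity)
  calc T = n * (1 / n * T) := by field_simp
    _ ≤ _ := by gcongr

theorem rpow_mul_prod_erase_eq {n : ℕ} (hn : 1 ≤ n) {d : ℝ} (hd : 0 < d) {x : Fin n → ℝ}
    (hx : ∀ i, x i ∈ Set.Icc 0 d) (q : ℝ) (i : Fin n) :
    x i ^ q * ∏ j ∈ Finset.univ.erase i, (d - x j) ^ q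
      = d ^ (n * q) * (x i / d * ∏ j ∈ Finset.univ.erase i, (1 - x j / d)) ^ q := by
  have hsub : ∀ j, 0 ≤ d - x j := fun j => by linarith [(hx j).2]
  have hscale : ∀ j, 1 - x j / d = (d - x j) / d := fun j => by field_simp
  have hcard : (Finset.univ.erase i).card = n - 1 := by
    rw [Finset.card_erase_of_mem (Finset.mem_univ i), Finset.card_univ, Fintype.card_fin]
  rw [Real.finsetProd_rpow _ _ (fun j _ => hsub j),
    ← Real.mul_rpow (hx i).1 (Finset.prod_nonneg fun j _ => hsub j),
    Real.rpow_mul hd.le, Real.rpow_natCast, ← Real.mul_rpow (by positivity)]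
  · congr 1
    simp only [hscale]
    rw [Finset.prod_div_distrib, Finset.prod_const, hcard]
    obtain ⟨m, rfl⟩ := Nat.exists_eq_add_of_le' hn
    rw [Nat.add_sub_cancel, pow_succ]
    field_simp
  · exact mul_nonneg (div_nonneg (hx i).1 hd.le)
      (Finset.prod_nonneg fun j _ => by rw [hscale]; exact div_nonneg (hsub j) hd.le)

theorem card_mul_rpow_eq {n : ℕ} (hn : 1 ≤ n) (p : ℝ) :
    n * (1 / n * (1 - 1 / n) ^ (n - 1) : ℝ) ^ (1 / p)
      = (n : ℝ) ^ (1 - 1 / p) * (1 - 1 / (n : ℝ)) ^ (((n : ℝ) - 1) / p) := by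
  have hn1 : (1 : ℝ) ≤ n := by exact_mod_cast hn
  have hn0 : (0 : ℝ) < n := by linarith
  have hq : 0 ≤ 1 - 1 / (n : ℝ) := by
    rw [sub_nonneg, div_le_one hn0]
    exact hn1
  rw [Real.mul_rpow (by positivity) (pow_nonneg hq _), ← mul_assoc, Real.rpow_sub hn0,
    Real.rpow_one, Real.div_rpow zero_le_one hn0.le, Real.one_rpow, mul_one_div,
    ← Real.rpow_natCast, ← Real.rpow_mul hq, Nat.cast_sub hn, Nat.cast_one, mul_one_div]


/-- For integers `3 ≤ d`, `2 ≤ n ≤ d` and real `p ∈ [2,∞)`, the function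
`f_n(x) = ∑_i x_i^{1/p} ∏_{j≠i} (d−x_j)^{1/p}` on `[0,d]^n` is bounded above by
`d^{n/p} · n^{1−1/p} · (1−1/n)^{(n−1)/p}`, which is its value at `x_1 = ⋯ = x_n = d/n`. -/
theorem aux_max_on_box (d n : ℕ) (hd : 3 ≤ d) (hn : 2 ≤ n) (hnd : n ≤ d)
    (p : ℝ) (hp : 2 ≤ p) :
    (∀ x : Fin n → ℝ, (∀ i, x i ∈ Set.Icc (0 : ℝ) (d : ℝ)) →
      ∑ i, (x i) ^ (1 / p) * ∏ j ∈ Finset.univ.erase i, ((d : ℝ) - x j) ^ (1 / p)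
        ≤ (d : ℝ) ^ ((n : ℝ) / p) * (n : ℝ) ^ (1 - 1 / p) *
            (1 - 1 / (n : ℝ)) ^ (((n : ℝ) - 1) / p)) ∧
    (∑ i : Fin n, ((d : ℝ) / n) ^ (1 / p) *
        ∏ j ∈ Finset.univ.erase i, ((d : ℝ) - (d : ℝ) / n) ^ (1 / p))
      = (d : ℝ) ^ ((n : ℝ) / p) * (n : ℝ) ^ (1 - 1 / p) *
          (1 - 1 / (n : ℝ)) ^ (((n : ℝ) - 1) / p) := by
  have hd0 : (0 : ℝ) < d := by exact_mod_cast (by omega : 0 < d)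
  have hn0 : (0 : ℝ) < n := by exact_mod_cast (by omega : 0 < n)
  have hn1 : 1 ≤ n := by omega
  have hexp : (n : ℝ) / p = n * (1 / p) := by ring
  rw [mul_assoc, ← card_mul_rpow_eq hn1, hexp]
  refine ⟨fun x hx => ?_, ?_⟩
  · simp only [rpow_mul_prod_erase_eq hn1 hd0 hx, ← Finset.mul_sum]
    gcongr
    exact sum_rpow_mul_prod_erase_le hn
      (fun i => ⟨div_nonneg (hx i).1 hd0.le, (div_le_one hd0).2 (hx i).2⟩) hp
  · have hmem : ∀ _ : Fin n, (d : ℝ) / n ∈ Set.Icc (0 : ℝ) d := fun _ =>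
      ⟨by positivity, div_le_self hd0.le (by exact_mod_cast hn1)⟩
    have hdiv : (d : ℝ) / n / d = 1 / n := by field_simp
    rw [Finset.sum_congr rfl fun i _ => rpow_mul_prod_erase_eq hn1 hd0 hmem (1 / p) i]
    simp only [hdiv, Finset.prod_const,
      Finset.card_erase_of_mem (Finset.mem_univ _), Finset.sum_const, Finset.card_univ,
      Fintype.card_fin, nsmul_eq_mul]
    ring
end

section
/- For every real number p ≥ 2, 1 + 1/(p−1)^2 ≤ 2^{1/(p−1)}. -/
/-- For every real `p ≥ 2`, `1 + 1/(p−1)² ≤ 2^{1/(p−1)}`. -/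
theorem one_add_inv_sq_le_rpow (p : ℝ) (hp : 2 ≤ p) :
    1 + 1 / (p - 1) ^ 2 ≤ (2 : ℝ) ^ (1 / (p - 1)) := by
  have hx0 : 0 ≤ 1 / (p - 1) := one_div_nonneg.mpr (by linarith)
  have hx1 : 1 / (p - 1) ≤ 1 := (div_le_one (by linarith)).mpr (by linarith)
  rw [← one_div_pow]
  generalize 1 / (p - 1) = x at hx0 hx1 ⊢
  have bernoulli : (2 : ℝ) ^ (1 - x) ≤ 2 - x := by
    have h := rpow_one_add_le_one_add_mul_self (s := 1) (p := 1 - x) (by norm_num)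
      (by linarith) (by linarith)
    rw [one_add_one_eq_two] at h
    linarith
  have hmul : (2 : ℝ) ^ x * 2 ^ (1 - x) = 2 := by
    rw [← Real.rpow_add two_pos, add_sub_cancel, Real.rpow_one]
  refine le_of_mul_le_mul_right ?_ (Real.rpow_pos_of_pos two_pos (1 - x))
  calc (1 + x ^ 2) * (2 : ℝ) ^ (1 - x) ≤ (1 + x ^ 2) * (2 - x) := by gcongr
    _ ≤ 2 := by nlinarith [mul_nonneg hx0 (sq_nonneg (1 - x))]
    _ = 2 ^ x * 2 ^ (1 - x) := hmul.symm
end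

section
/- Let n ≥ 3 be an integer and define h : [2,∞) → ℝ by h(p) = (n−1)^p · (1 − (n−1)^{1/(1−p)}). Then h is monotone nondecreasing on [2,∞): for all real numbers 2 ≤ p_1 ≤ p_2, h(p_1) ≤ h(p_2). -/
open Real in
/-- The chord-type bound `1 + t² ≤ 2 ^ t` on the unit interval. -/
theorem one_add_sq_le_exp_log_two_mul {t : ℝ} (h0 : 0 ≤ t) (h1 : t ≤ 1) :
    1 + t ^ 2 ≤ exp (log 2 * t) := by
  have hl := Real.log_two_gt_d9
  have hu := Real.log_two_lt_d9
  rcases le_total t (1 / 2) with h | h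
  · have := add_one_le_exp (log 2 * t)
    nlinarith
  · have h2 : exp (log 2 * t) = 2 * exp (-(log 2 * (1 - t))) := by
      nth_rewrite 2 [← exp_log (show (0 : ℝ) < 2 by norm_num)]
      rw [← exp_add]
      ring_nf
    have := add_one_le_exp (-(log 2 * (1 - t)))
    rw [h2]
    nlinarith

open Real in
theorem hasDerivAt_exp_mul_one_sub_exp (L : ℝ) {p : ℝ} (hp : 1 - p ≠ 0) :
    HasDerivAt (fun x : ℝ => exp (L * x) * (1 - exp (L * (1 / (1 - x)))))
      (L * exp (L * p) * (1 - (1 + (1 / (1 - p)) ^ 2) * exp (L * (1 / (1 - p))))) p := by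
  have h1 : HasDerivAt (fun x : ℝ => L * x) L p := by
    simpa using (hasDerivAt_id p).const_mul L
  have h2 : HasDerivAt (fun x : ℝ => 1 / (1 - x)) ((1 / (1 - p)) ^ 2) p := by
    have := ((hasDerivAt_id p).const_sub 1).fun_inv hp
    simpa [one_div] using this
  have h3 := h1.exp.mul (((h2.const_mul L).exp).const_sub 1)
  refine h3.congr_deriv ?_
  ring

open Real in
theorem monotoneOn_exp_mul_one_sub_exp {L : ℝ} (hL : log 2 ≤ L) :
    MonotoneOn (fun x : ℝ => exp (L * x) * (1 - exp (L * (1 / (1 - x))))) (Set.Ici 2) := by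
  have hL0 : 0 ≤ L := (log_nonneg (by norm_num)).trans hL
  have hd : ∀ x ∈ Set.Ici (2 : ℝ), 1 - x ≠ 0 := fun x hx => by
    have : (2 : ℝ) ≤ x := hx
    linarith
  refine monotoneOn_of_hasDerivWithinAt_nonneg (convex_Ici 2)
    (fun x hx => (hasDerivAt_exp_mul_one_sub_exp L (hd x hx)).continuousAt.continuousWithinAt)
    (fun x hx => (hasDerivAt_exp_mul_one_sub_exp L
      (hd x (interior_subset hx))).hasDerivWithinAt) (fun x hx => ?_)
  have hx2 : (2 : ℝ) ≤ x := interior_subset hx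
  have ht0 : 0 ≤ 1 / (x - 1) := by
    have : 0 ≤ x - 1 := by linarith
    positivity
  have ht1 : 1 / (x - 1) ≤ 1 := by
    rw [div_le_one (by linarith)]
    linarith
  have ht : 1 / (1 - x) = -(1 / (x - 1)) := by
    rw [← neg_sub x 1, div_neg]
  rw [ht]
  generalize 1 / (x - 1) = t at ht0 ht1
  have hb : 1 + t ^ 2 ≤ exp (L * t) :=
    (one_add_sq_le_exp_log_two_mul ht0 ht1).trans (exp_le_exp.2 (by gcongr))
  have hm := mul_le_mul_of_nonneg_right hb (exp_pos (L * -t)).le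
  rw [← exp_add, mul_neg, add_neg_cancel, exp_zero] at hm
  rw [neg_sq, mul_neg]
  exact mul_nonneg (mul_nonneg hL0 (exp_pos _).le) (sub_nonneg.2 hm)

/-- For an integer `n ≥ 3`, the function `h(p) = (n−1)^p · (1 − (n−1)^{1/(1−p)})`
is monotone nondecreasing on `[2,∞)`. -/
theorem h_monotone (n : ℕ) (hn : 3 ≤ n) (p₁ p₂ : ℝ) (hp₁ : 2 ≤ p₁) (hp₁₂ : p₁ ≤ p₂) :
    ((n : ℝ) - 1) ^ p₁ * (1 - ((n : ℝ) - 1) ^ (1 / (1 - p₁)))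
      ≤ ((n : ℝ) - 1) ^ p₂ * (1 - ((n : ℝ) - 1) ^ (1 / (1 - p₂))) := by
  have hn' : (3 : ℝ) ≤ n := by exact_mod_cast hn
  have ha : (2 : ℝ) ≤ (n : ℝ) - 1 := by linarith
  have ha0 : (0 : ℝ) < (n : ℝ) - 1 := by linarith
  simp only [Real.rpow_def_of_pos ha0]
  exact monotoneOn_exp_mul_one_sub_exp (Real.log_le_log two_pos ha)
    (Set.mem_Ici.2 hp₁) (Set.mem_Ici.2 (hp₁.trans hp₁₂)) hp₁₂
end

section
/- Let p ∈ (2,∞] with conjugate q = p/(p−1), and let B be any real m×n matrix. Then ‖B‖_{p→q} ≤ vec_p(B). -/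
open scoped ENNReal
open Matrix

/-- The convex relaxation value `vec_p(B)`: the supremum of `B̃ • X` over positive
semidefinite `X` with `∑_{i≤m} X_{ii}^{p/2} ≤ 1` and `∑_{j>m} X_{jj}^{p/2} ≤ 1`
(for `p = ∞`: all diagonal entries at most `1`), where
`B̃ = (1/2)·[[0,B],[Bᵀ,0]]` and `P • Q = tr(PᵀQ)`. -/
noncomputable def vecp {m n : ℕ} (p : ℝ≥0∞) (B : Matrix (Fin m) (Fin n) ℝ) : ℝ :=
  sSup {v : ℝ | ∃ X : Matrix (Fin m ⊕ Fin n) (Fin m ⊕ Fin n) ℝ,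
    X.PosSemidef ∧
    (if p = ∞ then ∀ i, X i i ≤ 1
     else
      (∑ i : Fin m, (X (Sum.inl i) (Sum.inl i)) ^ (p.toReal / 2)) ≤ 1 ∧
      (∑ j : Fin n, (X (Sum.inr j) (Sum.inr j)) ^ (p.toReal / 2)) ≤ 1) ∧
    Matrix.trace
      ((((1 : ℝ) / 2) • Matrix.fromBlocks (0 : Matrix (Fin m) (Fin m) ℝ) B
          Bᵀ (0 : Matrix (Fin n) (Fin n) ℝ))ᵀ * X) = v}

/-- The pairing of `B̃` with a symmetric matrix `X` only sees the off-diagonal block of `X`. -/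
theorem trace_bipartite_mul {m n : ℕ} (B : Matrix (Fin m) (Fin n) ℝ)
    {X : Matrix (Fin m ⊕ Fin n) (Fin m ⊕ Fin n) ℝ} (hX : ∀ i j, X i j = X j i) :
    Matrix.trace
      ((((1 : ℝ) / 2) • Matrix.fromBlocks (0 : Matrix (Fin m) (Fin m) ℝ) B
          Bᵀ (0 : Matrix (Fin n) (Fin n) ℝ))ᵀ * X)
      = ∑ i, ∑ j, B i j * X (Sum.inl i) (Sum.inr j) := by
  have h : ∑ j, ∑ i, B i j * X (Sum.inl i) (Sum.inr j)
      = ∑ i, ∑ j, B i j * X (Sum.inl i) (Sum.inr j) := Finset.sum_comm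
  simp only [Matrix.trace, Matrix.diag, Matrix.mul_apply, Matrix.transpose_apply,
    Matrix.smul_apply, Fintype.sum_sum_type, Matrix.fromBlocks_apply₁₁,
    Matrix.fromBlocks_apply₁₂, Matrix.fromBlocks_apply₂₁, Matrix.fromBlocks_apply₂₂,
    Matrix.zero_apply, smul_eq_mul, zero_mul, Finset.sum_const_zero, zero_add,
    add_zero, hX (Sum.inr _) (Sum.inl _), mul_assoc, ← Finset.mul_sum, h]
  ring

/-- Every entry of a positive semidefinite matrix with diagonal at most `1` is at most `1`
in absolute value. -/
theorem Matrix.PosSemidef.abs_apply_le_one {ι : Type*} [Fintype ι] [DecidableEq ι]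
    {X : Matrix ι ι ℝ} (hX : X.PosSemidef) (hd : ∀ i, X i i ≤ 1) (i j : ι) :
    |X i j| ≤ 1 := by
  have hs : X j i = X i j := by simpa using hX.1.apply i j
  have key : ∀ c : ℝ, 0 ≤ X i i + c * X i j + c * (X i j + c * X j j) := by
    intro c
    have h := hX.dotProduct_mulVec_nonneg (Pi.single i 1 + c • Pi.single j 1)
    simp [Matrix.mulVec_add, Matrix.mulVec_smul, hs] at h
    linarith
  have h1 := key 1
  have h2 := key (-1)
  have hi := hd i
  have hj := hd j
  rw [abs_le]
  constructor <;> linarith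

theorem le_one_of_rpow_le_one {a r : ℝ} (hr : 0 < r) (h : a ^ r ≤ 1) : a ≤ 1 :=
  not_lt.mp fun ha => h.not_gt (Real.one_lt_rpow ha hr)

/-- The finite-`p` feasibility constraint bounds each summand. -/
theorem le_one_of_sum_rpow_le_one {ι : Type*} [Fintype ι] {r : ℝ} (hr : 0 < r) {f : ι → ℝ}
    (hf : ∀ i, 0 ≤ f i) (h : ∑ i, f i ^ r ≤ 1) (i : ι) : f i ≤ 1 := by
  have h1 : f i ^ r ≤ 1 :=
    (Finset.single_le_sum (fun j _ => Real.rpow_nonneg (hf j) r) (Finset.mem_univ i)).trans h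
  exact le_one_of_rpow_le_one hr h1

/-- `L_q` norms are attained by pairing with the unit ball of the conjugate `L_p` norm. -/
theorem exists_dotProduct_eq_Lq {ι : Type*} [Fintype ι] {p q : ℝ} (hpq : q.HolderConjugate p)
    (w : ι → ℝ) :
    ∃ x : ι → ℝ, ∑ i, |x i| ^ p ≤ 1 ∧ x ⬝ᵥ w = (∑ i, |w i| ^ q) ^ (1 / q) := by
  obtain ⟨g, hg, hgw⟩ := (NNReal.isGreatest_Lp Finset.univ (fun i => ‖w i‖₊) hpq).1
  refine ⟨fun i => SignType.sign (w i) * g i, ?_, ?_⟩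
  · calc ∑ i, |(SignType.sign (w i) : ℝ) * g i| ^ p ≤ ∑ i, (g i : ℝ) ^ p := by
          refine Finset.sum_le_sum fun i _ => Real.rpow_le_rpow (abs_nonneg _) ?_ hpq.symm.nonneg
          rw [abs_mul, NNReal.abs_eq]
          refine mul_le_of_le_one_left (g i).2 ?_
          rcases lt_trichotomy (w i) 0 with h | h | h <;> simp [h]
      _ ≤ 1 := by exact_mod_cast hg
  · have h := congrArg NNReal.toReal hgw
    push_cast at h
    simp only [Real.norm_eq_abs] at h
    rw [← h, dotProduct]
    refine Finset.sum_congr rfl fun i _ => ?_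
    rw [mul_right_comm, sign_mul_self]

theorem mul_self_rpow_half (a p : ℝ) : (a * a) ^ (p / 2) = |a| ^ p := by
  rw [← abs_mul_abs_self, ← sq, ← Real.rpow_natCast, ← Real.rpow_mul (abs_nonneg a)]
  congr 1
  push_cast
  ring

/-- The values defining `vecp p B` are bounded above. -/
theorem bddAbove_vecp {m n : ℕ} {p : ℝ≥0∞} (hp : 2 < p) (B : Matrix (Fin m) (Fin n) ℝ) :
    BddAbove {v : ℝ | ∃ X : Matrix (Fin m ⊕ Fin n) (Fin m ⊕ Fin n) ℝ,
      X.PosSemidef ∧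
      (if p = ∞ then ∀ i, X i i ≤ 1
       else
        (∑ i : Fin m, (X (Sum.inl i) (Sum.inl i)) ^ (p.toReal / 2)) ≤ 1 ∧
        (∑ j : Fin n, (X (Sum.inr j) (Sum.inr j)) ^ (p.toReal / 2)) ≤ 1) ∧
      Matrix.trace
        ((((1 : ℝ) / 2) • Matrix.fromBlocks (0 : Matrix (Fin m) (Fin m) ℝ) B
            Bᵀ (0 : Matrix (Fin n) (Fin n) ℝ))ᵀ * X) = v} := by
  refine ⟨∑ i, ∑ j, |B i j|, ?_⟩
  rintro _ ⟨X, hX, hc, rfl⟩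
  have hd : ∀ i, X i i ≤ 1 := by
    split_ifs at hc with h
    · exact hc
    · have hr : 0 < p.toReal / 2 := half_pos (ENNReal.toReal_pos (pos_of_gt hp).ne' h)
      rintro (i | j)
      · exact le_one_of_sum_rpow_le_one hr (fun _ => hX.diag_nonneg) hc.1 i
      · exact le_one_of_sum_rpow_le_one hr (fun _ => hX.diag_nonneg) hc.2 j
  rw [trace_bipartite_mul B fun i j => by simpa using hX.1.apply j i]
  refine Finset.sum_le_sum fun i _ => Finset.sum_le_sum fun j _ => ?_
  refine (le_abs_self _).trans ?_
  rw [abs_mul]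
  exact mul_le_of_le_one_right (abs_nonneg _) (hX.abs_apply_le_one hd _ _)

/-- A pair of vectors feasible for the bilinear problem gives a rank-one feasible point
of the relaxation. -/
theorem dotProduct_mulVec_le_vecp {m n : ℕ} {p : ℝ≥0∞} (hp : 2 < p)
    (B : Matrix (Fin m) (Fin n) ℝ) (x : Fin m → ℝ) (y : Fin n → ℝ)
    (h : if p = ∞ then (∀ i, |x i| ≤ 1) ∧ ∀ j, |y j| ≤ 1
      else ∑ i, |x i| ^ p.toReal ≤ 1 ∧ ∑ j, |y j| ^ p.toReal ≤ 1) :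
    x ⬝ᵥ B *ᵥ y ≤ vecp p B := by
  have hX : (vecMulVec (Sum.elim x y) (Sum.elim x y)).PosSemidef := by
    simpa using posSemidef_vecMulVec_self_star (Sum.elim x y)
  refine le_csSup (bddAbove_vecp hp B) ⟨_, hX, ?_, ?_⟩
  · split_ifs at h ⊢
    · have hsq {a : ℝ} (ha : |a| ≤ 1) : a * a ≤ 1 := by
        rw [← abs_mul_abs_self]
        exact mul_le_one₀ ha (abs_nonneg a) ha
      rintro (i | j)
      · exact hsq (h.1 i)
      · exact hsq (h.2 j)
    · simpa only [vecMulVec_apply, Sum.elim_inl, Sum.elim_inr, mul_self_rpow_half] using h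
  · rw [trace_bipartite_mul B fun i j => by simp [vecMulVec_apply, mul_comm]]
    simp only [vecMulVec_apply, Sum.elim_inl, Sum.elim_inr, dotProduct, mulVec, Finset.mul_sum]
    exact Finset.sum_congr rfl fun i _ => Finset.sum_congr rfl fun j _ => by ring

/-- For `p ∈ (2,∞]` with conjugate `q = p/(p−1)`, and any real `m×n` matrix `B`,
`‖B‖_{p→q} ≤ vec_p(B)`. -/
theorem pq_norm_le_vecp (m n : ℕ) (p : ℝ≥0∞) (hp : 2 < p)
    (B : Matrix (Fin m) (Fin n) ℝ) :
    sSup {v : ℝ | ∃ y : Fin n → ℝ, lpNorm p y ≤ 1 ∧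
        lpNorm (if p = ∞ then 1 else ENNReal.ofReal (p.toReal / (p.toReal - 1)))
          (B.mulVec y) = v}
      ≤ vecp p B := by
  have h0 : 0 ≤ vecp p B := by
    simpa using dotProduct_mulVec_le_vecp hp B 0 0 (by
      split_ifs with h
      · simp
      · simp [Real.zero_rpow (ENNReal.toReal_pos (pos_of_gt hp).ne' h).ne'])
  refine Real.sSup_le ?_ h0
  rintro _ ⟨y, hy, rfl⟩
  by_cases h : p = ∞
  · have hy' : ∀ j, |y j| ≤ 1 := fun j => by
      rw [lpNorm, if_pos h] at hy
      exact (le_ciSup (Set.finite_range fun i => |y i|).bddAbove j).trans hy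
    have hle := dotProduct_mulVec_le_vecp hp B (fun i => SignType.sign ((B *ᵥ y) i)) y (by
      rw [if_pos h]
      refine ⟨fun i => ?_, hy'⟩
      rcases lt_trichotomy ((B *ᵥ y) i) 0 with h | h | h <;> simp [h])
    simpa [lpNorm, h, dotProduct, sign_mul_self] using hle
  · have hp2 : 2 < p.toReal := by
      simpa using (ENNReal.toReal_lt_toReal (by simp) h).2 hp
    have hpq : p.toReal.HolderConjugate (p.toReal / (p.toReal - 1)) :=
      Real.HolderConjugate.conjExponent (by linarith)
    obtain ⟨x, hx, hxw⟩ := exists_dotProduct_eq_Lq hpq.symm (B *ᵥ y)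
    rw [if_neg h, lpNorm, if_neg ENNReal.ofReal_ne_top,
      ENNReal.toReal_ofReal hpq.symm.nonneg, ← hxw]
    refine dotProduct_mulVec_le_vecp hp B x y ?_
    rw [if_neg h]
    rw [lpNorm, if_neg h] at hy
    exact ⟨hx, le_one_of_rpow_le_one (one_div_pos.2 hpq.pos) hy⟩
end

section
/- Let p ∈ (2,∞] and let A = (a_{ijk}) ∈ ℝ^{n_1×n_2×n_3} be a non-zero order-3 tensor whose flattening Â (the (n_2 n_3)×n_1 matrix with Â_{(j,k),i} = a_{ijk}) has full column rank. Then the function N : ℝ^{n_1} → ℝ given by N(x) = vec_p(A(x)) is a norm on ℝ^{n_1}: N(x) ≥ 0 for all x; N(cx) = |c|·N(x) for all c ∈ ℝ and x ∈ ℝ^{n_1}; N(x+y) ≤ N(x)+N(y) for all x,y ∈ ℝ^{n_1}; and N(x) = 0 implies x = 0. -/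
open scoped ENNReal
open Matrix

/-- For an order-3 tensor `A` and `x ∈ ℝ^{n₁}`, the `n₂ × n₃` matrix `A(x)` with
entries `[A(x)]_{jk} = ∑_i a_{ijk} x_i`. -/
noncomputable def contr {n₁ n₂ n₃ : ℕ} (A : Fin n₁ → Fin n₂ → Fin n₃ → ℝ)
    (x : Fin n₁ → ℝ) : Matrix (Fin n₂) (Fin n₃) ℝ :=
  Matrix.of fun j k => ∑ i, A i j k * x i

/-- The constraint set of the semidefinite program defining `vecp`. -/
def VecpFeasible {m n : ℕ} (p : ℝ≥0∞) (X : Matrix (Fin m ⊕ Fin n) (Fin m ⊕ Fin n) ℝ) : Prop :=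
  X.PosSemidef ∧
    (if p = ∞ then ∀ i, X i i ≤ 1
     else
      (∑ i : Fin m, (X (Sum.inl i) (Sum.inl i)) ^ (p.toReal / 2)) ≤ 1 ∧
      (∑ j : Fin n, (X (Sum.inr j) (Sum.inr j)) ^ (p.toReal / 2)) ≤ 1)

/-- The pairing of `B` with the upper right block of `X`. -/
def blockPairing {m n : ℕ} (B : Matrix (Fin m) (Fin n) ℝ)
    (X : Matrix (Fin m ⊕ Fin n) (Fin m ⊕ Fin n) ℝ) : ℝ :=
  ∑ i, ∑ j, B i j * X (Sum.inl i) (Sum.inr j)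

section

variable {m n : ℕ} {p : ℝ≥0∞}

theorem trace_eq_blockPairing (B : Matrix (Fin m) (Fin n) ℝ)
    {X : Matrix (Fin m ⊕ Fin n) (Fin m ⊕ Fin n) ℝ} (hX : X.PosSemidef) :
    Matrix.trace
      ((((1 : ℝ) / 2) • Matrix.fromBlocks (0 : Matrix (Fin m) (Fin m) ℝ) B
          Bᵀ (0 : Matrix (Fin n) (Fin n) ℝ))ᵀ * X) = blockPairing B X := by
  have hs : ∀ i j, X i j = X j i := fun i j => by simpa using hX.1.apply j i
  have h₁ : ∑ j, ∑ i, B i j * X (Sum.inl i) (Sum.inr j) = blockPairing B X :=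
    Finset.sum_comm
  have h₂ : ∑ i, ∑ j, B i j * X (Sum.inr j) (Sum.inl i) = blockPairing B X :=
    Finset.sum_congr rfl fun i _ => Finset.sum_congr rfl fun j _ => by rw [hs]
  simp only [Matrix.trace, Matrix.diag_apply, Matrix.mul_apply, Matrix.transpose_apply,
    Matrix.smul_apply, Fintype.sum_sum_type, Matrix.fromBlocks_apply₁₁,
    Matrix.fromBlocks_apply₁₂, Matrix.fromBlocks_apply₂₁, Matrix.fromBlocks_apply₂₂,
    Matrix.zero_apply, smul_eq_mul, zero_mul, Finset.sum_const_zero, zero_add,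
    add_zero, mul_assoc, ← Finset.mul_sum]
  rw [h₁, h₂]
  ring

theorem vecp_eq_sSup_image (B : Matrix (Fin m) (Fin n) ℝ) :
    vecp p B = sSup (blockPairing B '' {X | VecpFeasible p X}) := by
  unfold vecp
  congr 1
  ext v
  constructor
  · rintro ⟨X, hX, hd, hv⟩
    exact ⟨X, ⟨hX, hd⟩, by rw [← hv, trace_eq_blockPairing B hX]⟩
  · rintro ⟨X, ⟨hX, hd⟩, hv⟩
    exact ⟨X, hX, hd, by rw [trace_eq_blockPairing B hX, hv]⟩

theorem half_toReal_pos (hp : 2 < p) (hp' : p ≠ ∞) : 0 < p.toReal / 2 :=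
  half_pos (ENNReal.toReal_pos (by rintro rfl; simp at hp) hp')

theorem VecpFeasible.zero (hp : 2 < p) :
    VecpFeasible p (0 : Matrix (Fin m ⊕ Fin n) (Fin m ⊕ Fin n) ℝ) := by
  refine ⟨Matrix.PosSemidef.zero, ?_⟩
  split_ifs with h
  · simp
  · simp [Real.zero_rpow (half_toReal_pos hp h).ne']

theorem VecpFeasible.diag_le_one (hp : 2 < p)
    {X : Matrix (Fin m ⊕ Fin n) (Fin m ⊕ Fin n) ℝ} (hX : VecpFeasible p X) (i) : X i i ≤ 1 := by
  obtain ⟨hX, hd⟩ := hX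
  have h0 : ∀ i, 0 ≤ X i i := fun i => hX.diag_nonneg
  split_ifs at hd with h
  · exact hd i
  · have hq := half_toReal_pos hp h
    have key : X i i ^ (p.toReal / 2) ≤ 1 := by
      cases i with
      | inl i =>
        exact (Finset.single_le_sum
          (f := fun i => X (Sum.inl i) (Sum.inl i) ^ (p.toReal / 2))
          (fun i _ => Real.rpow_nonneg (h0 _) _) (Finset.mem_univ i)).trans hd.1
      | inr j =>
        exact (Finset.single_le_sum
          (f := fun j => X (Sum.inr j) (Sum.inr j) ^ (p.toReal / 2))
          (fun i _ => Real.rpow_nonneg (h0 _) _) (Finset.mem_univ j)).trans hd.2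
    by_contra! hlt
    exact absurd key (not_le.mpr (Real.one_lt_rpow hlt hq))

theorem Matrix.PosSemidef.two_mul_abs_apply_le {ι : Type*} [Fintype ι] [DecidableEq ι]
    {X : Matrix ι ι ℝ} (hX : X.PosSemidef) (i j : ι) : 2 * |X i j| ≤ X i i + X j j := by
  have hs : X j i = X i j := by simpa using hX.1.apply i j
  have h₁ := hX.dotProduct_mulVec_nonneg (Pi.single i 1 + Pi.single j 1)
  have h₂ := hX.dotProduct_mulVec_nonneg (Pi.single i 1 - Pi.single j 1)
  simp [Matrix.mulVec_add, Matrix.mulVec_sub, add_dotProduct, sub_dotProduct] at h₁ h₂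
  rcases abs_cases (X i j) with h | h <;> linarith

theorem bddAbove_blockPairing_image (hp : 2 < p) (B : Matrix (Fin m) (Fin n) ℝ) :
    BddAbove (blockPairing B '' {X | VecpFeasible p X}) := by
  refine ⟨∑ i, ∑ j, |B i j|, ?_⟩
  rintro _ ⟨X, hX, rfl⟩
  refine Finset.sum_le_sum fun i _ => Finset.sum_le_sum fun j _ => ?_
  have h := hX.1.two_mul_abs_apply_le (Sum.inl i) (Sum.inr j)
  have h₁ := hX.diag_le_one hp (Sum.inl i)
  have h₂ := hX.diag_le_one hp (Sum.inr j)
  calc B i j * X (Sum.inl i) (Sum.inr j) ≤ |B i j| * |X (Sum.inl i) (Sum.inr j)| := by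
        rw [← abs_mul]; exact le_abs_self _
    _ ≤ |B i j| := mul_le_of_le_one_right (abs_nonneg _) (by linarith)

theorem blockPairing_le_vecp (hp : 2 < p) (B : Matrix (Fin m) (Fin n) ℝ)
    {X : Matrix (Fin m ⊕ Fin n) (Fin m ⊕ Fin n) ℝ} (hX : VecpFeasible p X) :
    blockPairing B X ≤ vecp p B := by
  rw [vecp_eq_sSup_image]
  exact le_csSup (bddAbove_blockPairing_image hp B) ⟨X, hX, rfl⟩

theorem vecp_le (hp : 2 < p) {B : Matrix (Fin m) (Fin n) ℝ} {c : ℝ}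
    (h : ∀ X, VecpFeasible p X → blockPairing B X ≤ c) : vecp p B ≤ c := by
  rw [vecp_eq_sSup_image]
  refine csSup_le ⟨_, 0, VecpFeasible.zero hp, rfl⟩ ?_
  rintro _ ⟨X, hX, rfl⟩
  exact h X hX

theorem vecp_nonneg (hp : 2 < p) (B : Matrix (Fin m) (Fin n) ℝ) : 0 ≤ vecp p B := by
  simpa [blockPairing] using blockPairing_le_vecp hp B (VecpFeasible.zero hp)

theorem vecp_add_le (hp : 2 < p) (B C : Matrix (Fin m) (Fin n) ℝ) :
    vecp p (B + C) ≤ vecp p B + vecp p C := by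
  refine vecp_le hp fun X hX => ?_
  have : blockPairing (B + C) X = blockPairing B X + blockPairing C X := by
    simp [blockPairing, add_mul, Finset.sum_add_distrib]
  rw [this]
  exact add_le_add (blockPairing_le_vecp hp B hX) (blockPairing_le_vecp hp C hX)

theorem blockPairing_smul (c : ℝ) (B : Matrix (Fin m) (Fin n) ℝ)
    (X : Matrix (Fin m ⊕ Fin n) (Fin m ⊕ Fin n) ℝ) :
    blockPairing (c • B) X = c * blockPairing B X := by
  simp [blockPairing, Finset.mul_sum, mul_assoc]

/-- Conjugating by `diag(1, -1)` preserves feasibility and negates the pairing. -/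
theorem VecpFeasible.exists_neg {X : Matrix (Fin m ⊕ Fin n) (Fin m ⊕ Fin n) ℝ}
    (hX : VecpFeasible p X) :
    ∃ Y, VecpFeasible p Y ∧
      ∀ B : Matrix (Fin m) (Fin n) ℝ, blockPairing B Y = -blockPairing B X := by
  let D : Matrix (Fin m ⊕ Fin n) (Fin m ⊕ Fin n) ℝ :=
    Matrix.diagonal (Sum.elim (fun _ => 1) (fun _ => -1))
  refine ⟨Dᴴ * X * D, ⟨hX.1.conjTranspose_mul_mul_same D, ?_⟩, fun B => ?_⟩
  · simpa [D, Matrix.diagonal_conjTranspose, Matrix.diagonal_mul, Matrix.mul_diagonal] using hX.2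
  · simp [D, blockPairing, Matrix.diagonal_mul, Matrix.mul_diagonal]

theorem vecp_smul_le (hp : 2 < p) (c : ℝ) (B : Matrix (Fin m) (Fin n) ℝ) :
    vecp p (c • B) ≤ |c| * vecp p B := by
  refine vecp_le hp fun X hX => ?_
  rw [blockPairing_smul]
  rcases abs_cases c with ⟨h, hc⟩ | ⟨h, hc⟩
  · rw [h]
    exact mul_le_mul_of_nonneg_left (blockPairing_le_vecp hp B hX) hc
  · obtain ⟨Y, hY, hYB⟩ := hX.exists_neg
    have := mul_le_mul_of_nonneg_left (blockPairing_le_vecp hp B hY) (neg_nonneg.mpr hc.le)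
    rw [h]
    rw [hYB] at this
    linarith

theorem vecp_smul (hp : 2 < p) (c : ℝ) (B : Matrix (Fin m) (Fin n) ℝ) :
    vecp p (c • B) = |c| * vecp p B := by
  refine le_antisymm (vecp_smul_le hp c B) ?_
  rcases eq_or_ne c 0 with rfl | hc
  · simpa using vecp_nonneg hp (0 : Matrix (Fin m) (Fin n) ℝ)
  · have h := vecp_smul_le hp c⁻¹ (c • B)
    rw [inv_smul_smul₀ hc, abs_inv] at h
    rwa [← le_inv_mul_iff₀ (abs_pos.mpr hc)]

theorem abs_apply_le_vecp (hp : 2 < p) (B : Matrix (Fin m) (Fin n) ℝ) (i : Fin m) (j : Fin n) :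
    |B i j| ≤ vecp p B := by
  obtain ⟨s, hs, hsB⟩ : ∃ s : ℝ, s * s = 1 ∧ B i j * s = |B i j| := by
    rcases abs_cases (B i j) with h | h
    · exact ⟨1, by norm_num, by rw [h.1, mul_one]⟩
    · exact ⟨-1, by norm_num, by rw [h.1, mul_neg_one]⟩
  let v : Fin m ⊕ Fin n → ℝ := Sum.elim (Pi.single i 1) (Pi.single j s)
  have hF : VecpFeasible p (Matrix.vecMulVec v v) := by
    refine ⟨by simpa using Matrix.posSemidef_vecMulVec_self_star v, ?_⟩
    have hl : ∀ k, v (Sum.inl k) * v (Sum.inl k) = if k = i then 1 else 0 := fun k => by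
      by_cases h : k = i <;> simp [v, h]
    have hr : ∀ k, v (Sum.inr k) * v (Sum.inr k) = if k = j then 1 else 0 := fun k => by
      by_cases h : k = j <;> simp [v, h, hs]
    simp only [Matrix.vecMulVec_apply, hl, hr, Sum.forall]
    split_ifs with h
    · exact ⟨fun k => by split_ifs <;> norm_num, fun k => by split_ifs <;> norm_num⟩
    · simp [apply_ite (· ^ (p.toReal / 2)),
        Real.zero_rpow (half_toReal_pos hp h).ne']
  have h := blockPairing_le_vecp hp B hF
  simpa [blockPairing, Matrix.vecMulVec_apply, v, Pi.single_apply, hsB] using h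

theorem eq_zero_of_vecp_eq_zero (hp : 2 < p) {B : Matrix (Fin m) (Fin n) ℝ}
    (h : vecp p B = 0) : B = 0 := by
  ext i j
  exact abs_nonpos_iff.mp (h ▸ abs_apply_le_vecp hp B i j)

end

theorem contr_add {n₁ n₂ n₃ : ℕ} (A : Fin n₁ → Fin n₂ → Fin n₃ → ℝ) (x y : Fin n₁ → ℝ) :
    contr A (x + y) = contr A x + contr A y := by
  ext j k
  simp [contr, mul_add, Finset.sum_add_distrib]

theorem contr_smul {n₁ n₂ n₃ : ℕ} (A : Fin n₁ → Fin n₂ → Fin n₃ → ℝ) (c : ℝ)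
    (x : Fin n₁ → ℝ) : contr A (c • x) = c • contr A x := by
  ext j k
  simp [contr, Finset.mul_sum, mul_left_comm]

/-- For `p ∈ (2,∞]` and a non-zero order-3 tensor `A` whose flattening has full column
rank (its columns are linearly independent), `x ↦ vec_p(A(x))` is a norm on `ℝ^{n₁}`. -/
theorem vecp_contr_is_norm (n₁ n₂ n₃ : ℕ) (p : ℝ≥0∞) (hp : 2 < p)
    (A : Fin n₁ → Fin n₂ → Fin n₃ → ℝ) (hA : A ≠ 0)
    (hrank : LinearIndependent ℝ
      (fun i : Fin n₁ => fun jk : Fin n₂ × Fin n₃ => A i jk.1 jk.2)) :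
    (∀ x : Fin n₁ → ℝ, 0 ≤ vecp p (contr A x)) ∧
    (∀ (c : ℝ) (x : Fin n₁ → ℝ), vecp p (contr A (c • x)) = |c| * vecp p (contr A x)) ∧
    (∀ x y : Fin n₁ → ℝ, vecp p (contr A (x + y)) ≤ vecp p (contr A x) + vecp p (contr A y)) ∧
    (∀ x : Fin n₁ → ℝ, vecp p (contr A x) = 0 → x = 0) := by
  refine ⟨fun x => vecp_nonneg hp _, fun c x => ?_, fun x y => ?_, fun x hx => ?_⟩
  · rw [contr_smul, vecp_smul hp]
  · rw [contr_add]
    exact vecp_add_le hp _ _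
  · have h0 := eq_zero_of_vecp_eq_zero hp hx
    refine funext (Fintype.linearIndependent_iff.mp hrank x ?_)
    ext jk
    simpa [contr, mul_comm] using congrFun (congrFun h0 jk.1) jk.2
end
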